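/- Let G be a finite graph with a percolation measure, let a₁, a₂, b be vertices and δ > 0 such that P(a₁↔b) < P(a₂↔b) + δ. If Q is a decreasing event determined by the cluster of a₁, then P(a₁↔b, Q) < P(a₂↔b, Q) + δ. -/

import Mathlib

open scoped BigOperators

structure PercGraph (V E : Type) where
  ends : E → V × V
  p : E → ℝ

namespace PercGraph

variable {V E : Type} [DecidableEq V] [Fintype E] [DecidableEq E]

/-- Weight of a configuration: each edge `e` is open (`ω e = true`) with probability `p e`. -/
def weight (G : PercGraph V E) (ω : E → Bool) : ℝ :=
  ∏ e, if ω e then G.p e else 1 - G.p e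

/-- Probability of an event under the percolation measure. -/
noncomputable def prob (G : PercGraph V E) (S : Set (E → Bool)) : ℝ :=
  ∑ ω : E → Bool, Set.indicator S G.weight ω

/-- Expectation of a function under the percolation measure. -/
noncomputable def expec (G : PercGraph V E) (f : (E → Bool) → ℝ) : ℝ :=
  ∑ ω : E → Bool, f ω * G.weight ω

/-- Two vertices are adjacent via an open edge in configuration `ω`. -/
def adj (G : PercGraph V E) (ω : E → Bool) (x y : V) : Prop :=
  ∃ e, ω e = true ∧ (G.ends e = (x, y) ∨ G.ends e = (y, x))

/-- `x` and `y` are connected by a path of open edges. -/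
def Conn (G : PercGraph V E) (ω : E → Bool) (x y : V) : Prop :=
  Relation.ReflTransGen (G.adj ω) x y

/-- The union of the open clusters of the vertices of `A`. -/
def cluster (G : PercGraph V E) (ω : E → Bool) (A : Set V) : Set V :=
  {y | ∃ a ∈ A, G.Conn ω a y}

/-- The event `x ↔ y`. -/
def connEvent (G : PercGraph V E) (x y : V) : Set (E → Bool) :=
  {ω | G.Conn ω x y}

/-- The event `x ↔ A`. -/
def connTo (G : PercGraph V E) (x : V) (A : Set V) : Set (E → Bool) :=
  {ω | ∃ a ∈ A, G.Conn ω x a}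

/-- The event `A ↮ B`. -/
def disconn (G : PercGraph V E) (A B : Set V) : Set (E → Bool) :=
  {ω | ∀ a ∈ A, ∀ b ∈ B, ¬ G.Conn ω a b}

def IncreasingEvent (S : Set (E → Bool)) : Prop :=
  ∀ ⦃ω ω' : E → Bool⦄, (∀ e, ω e = true → ω' e = true) → ω ∈ S → ω' ∈ S

def DecreasingEvent (S : Set (E → Bool)) : Prop :=
  ∀ ⦃ω ω' : E → Bool⦄, (∀ e, ω e = true → ω' e = true) → ω' ∈ S → ω ∈ S

def IncreasingFun (f : (E → Bool) → ℝ) : Prop :=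
  ∀ ⦃ω ω' : E → Bool⦄, (∀ e, ω e = true → ω' e = true) → f ω ≤ f ω'

/-- `f` is determined by the cluster of `A`. -/
def ClusterDetermined (G : PercGraph V E) (A : Set V) (f : (E → Bool) → ℝ) : Prop :=
  ∀ ω ω', G.cluster ω A = G.cluster ω' A → f ω = f ω'

/-- The event `S` is determined by the cluster of `A`. -/
def ClusterDeterminedEvent (G : PercGraph V E) (A : Set V) (S : Set (E → Bool)) : Prop :=
  ∀ ω ω', G.cluster ω A = G.cluster ω' A → (ω ∈ S ↔ ω' ∈ S)

noncomputable def condProb (G : PercGraph V E) (S T : Set (E → Bool)) : ℝ :=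
  G.prob (S ∩ T) / G.prob T

noncomputable def condExpec (G : PercGraph V E) (f : (E → Bool) → ℝ) (T : Set (E → Bool)) : ℝ :=
  G.expec (T.indicator f) / G.prob T

/-- The edge `e` is incident to the vertex `x`. -/
def incident (G : PercGraph V E) (x : V) (e : E) : Prop :=
  (G.ends e).1 = x ∨ (G.ends e).2 = x

/-- The other endpoint of an edge incident to `x`. -/
def otherEnd (G : PercGraph V E) (x : V) (e : E) : V :=
  if (G.ends e).1 = x then (G.ends e).2 else (G.ends e).1

/-- The graph `G ∖ W`: delete the vertices of `W` and all incident edges. -/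
def delete (G : PercGraph V E) (W : Finset V) :
    PercGraph V {e : E // (G.ends e).1 ∉ W ∧ (G.ends e).2 ∉ W} :=
  ⟨fun e => G.ends e.1, fun e => G.p e.1⟩

/-- The graph `G` with the probability of edge `e` replaced by `q`. -/
def withEdgeProb (G : PercGraph V E) (e : E) (q : ℝ) : PercGraph V E :=
  ⟨G.ends, Function.update G.p e q⟩

/-- Contraction of the edge `e`: set its probability to 1. -/
def contract (G : PercGraph V E) (e : E) : PercGraph V E :=
  G.withEdgeProb e 1

/-- The event that `e` is pivotal for `U`. -/
def pivotal (e : E) (U : Set (E → Bool)) : Set (E → Bool) :=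
  {ω | ¬ ((Function.update ω e true ∈ U) ↔ (Function.update ω e false ∈ U))}

/-- All edge probabilities lie in `[0,1]`. -/
def ProbValid (G : PercGraph V E) : Prop := ∀ e, 0 ≤ G.p e ∧ G.p e ≤ 1

end PercGraph
namespace PercGraph

section Expectation

variable {V E : Type} [Fintype E] {G : PercGraph V E}

theorem weight_nonneg (hp : G.ProbValid) (ω : E → Bool) : 0 ≤ G.weight ω := by
  refine Finset.prod_nonneg fun e _ => ?_
  have := hp e
  split_ifs <;> linarith

theorem sum_weight [DecidableEq E] (G : PercGraph V E) : ∑ ω : E → Bool, G.weight ω = 1 := by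
  have h := Finset.prod_univ_sum (fun _ : E => (Finset.univ : Finset Bool))
    (fun e b => if b = true then G.p e else 1 - G.p e)
  simp only [Fintype.piFinset_univ] at h
  unfold weight
  rw [← h]
  simp

theorem expec_one [DecidableEq E] (G : PercGraph V E) : G.expec 1 = 1 := by
  simp [expec, sum_weight]

theorem expec_sub [DecidableEq E] (G : PercGraph V E) (f g : (E → Bool) → ℝ) :
    G.expec (f - g) = G.expec f - G.expec g := by
  simp [expec, sub_mul, Finset.sum_sub_distrib]

theorem expec_mono [DecidableEq E] (hp : G.ProbValid) {f g : (E → Bool) → ℝ} (h : f ≤ g) :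
    G.expec f ≤ G.expec g :=
  Finset.sum_le_sum fun ω _ => mul_le_mul_of_nonneg_right (h ω) (weight_nonneg hp ω)

theorem expec_nonneg [DecidableEq E] (hp : G.ProbValid) {f : (E → Bool) → ℝ} (h : 0 ≤ f) :
    0 ≤ G.expec f :=
  Finset.sum_nonneg fun ω _ => mul_nonneg (h ω) (weight_nonneg hp ω)

theorem prob_eq_expec [DecidableEq E] (G : PercGraph V E) (S : Set (E → Bool)) :
    G.prob S = G.expec (S.indicator 1) := by
  classical
  simp [prob, expec, Set.indicator_apply]

/-- Conditioning on the state of the edge `e`. -/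
theorem expec_eq_update [DecidableEq E] (G : PercGraph V E) (e : E) (φ : (E → Bool) → ℝ) :
    G.expec φ = (1 - G.p e) * G.expec (fun ω => φ (Function.update ω e false))
      + G.p e * G.expec (fun ω => φ (Function.update ω e true)) := by
  have hw : ∀ (ω : E → Bool), G.weight ω = (if ω e then G.p e else 1 - G.p e) *
      ∏ i ∈ Finset.univ.erase e, (if ω i then G.p i else 1 - G.p i) := fun ω =>
    (Finset.mul_prod_erase _ _ (Finset.mem_univ e)).symm
  have hr : ∀ (ω : E → Bool) (c : Bool),
      ∏ i ∈ Finset.univ.erase e, (if Function.update ω e c i then G.p i else 1 - G.p i)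
        = ∏ i ∈ Finset.univ.erase e, (if ω i then G.p i else 1 - G.p i) := fun ω c =>
    Finset.prod_congr rfl fun i hi => by
      rw [Function.update_of_ne (Finset.ne_of_mem_erase hi)]
  have hflip : ∀ (ψ : (E → Bool) → ℝ),
      ∑ ω, ψ ω = ∑ ω : E → Bool, ψ (Function.update ω e (!ω e)) := fun ψ => by
    symm
    refine Fintype.sum_bijective (fun ω : E → Bool => Function.update ω e (!ω e))
      (Function.Involutive.bijective fun ω => ?_) _ _ fun ω => rfl
    simp
  have key : 2 * G.expec φ = 2 * ((1 - G.p e) * G.expec (fun ω => φ (Function.update ω e false))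
      + G.p e * G.expec (fun ω => φ (Function.update ω e true))) := by
    have hdouble : ∀ ψ : (E → Bool) → ℝ, 2 * G.expec ψ
        = ∑ ω : E → Bool, (ψ ω * G.weight ω + ψ (Function.update ω e (!ω e)) *
          G.weight (Function.update ω e (!ω e))) := fun ψ => by
      rw [Finset.sum_add_distrib, ← hflip (fun ω => ψ ω * G.weight ω), two_mul]
      rfl
    rw [mul_add, mul_left_comm, mul_left_comm 2 (G.p e)]
    simp only [hdouble]
    rw [Finset.mul_sum, Finset.mul_sum, ← Finset.sum_add_distrib]
    refine Finset.sum_congr rfl fun ω _ => ?_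
    rw [hw ω, hw (Function.update ω e (!ω e)), hr]
    have hself : Function.update ω e (ω e) = ω := Function.update_eq_self e ω
    cases h : ω e <;> rw [h] at hself <;> simp [hself] <;> ring
  linarith

/-- The Harris inequality. -/
theorem harris [DecidableEq E] (hp : G.ProbValid) {f g : (E → Bool) → ℝ} (hf₀ : 0 ≤ f)
    (hg₀ : 0 ≤ g) (hf : Monotone f) (hg : Monotone g) :
    G.expec f * G.expec g ≤ G.expec (f * g) := by
  have h := fkg (μ := G.weight) f g (fun ω => weight_nonneg hp ω) hf₀ hg₀ hf hg (fun a b => by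
    unfold weight
    rw [← Finset.prod_mul_distrib, ← Finset.prod_mul_distrib]
    refine (Finset.prod_congr rfl fun e _ => ?_).le
    cases ha : a e <;> cases hb : b e <;> simp [ha, hb, mul_comm])
  rw [sum_weight, one_mul] at h
  simpa only [expec, Pi.mul_apply, mul_comm (G.weight _)] using h

theorem harris_antitone [DecidableEq E] (hp : G.ProbValid) {f g : (E → Bool) → ℝ} (hf₁ : f ≤ 1)
    (hg₁ : g ≤ 1) (hf : Antitone f) (hg : Antitone g) :
    G.expec f * G.expec g ≤ G.expec (f * g) := by
  have h := harris hp (f := 1 - f) (g := 1 - g) (sub_nonneg.2 hf₁) (sub_nonneg.2 hg₁)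
    (fun _ _ h => sub_le_sub_left (hf h) _) (fun _ _ h => sub_le_sub_left (hg h) _)
  have hfg : (1 - f) * (1 - g) = 1 - f - (g - f * g) := by ring
  rw [hfg] at h
  simp only [expec_sub, expec_one] at h
  linarith

theorem harris_monotone_antitone [DecidableEq E] (hp : G.ProbValid) {f g : (E → Bool) → ℝ}
    (hf₀ : 0 ≤ f) (hg₁ : g ≤ 1) (hf : Monotone f) (hg : Antitone g) :
    G.expec (f * g) ≤ G.expec f * G.expec g := by
  have h := harris hp (g := 1 - g) hf₀ (sub_nonneg.2 hg₁) hf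
    (fun _ _ h => sub_le_sub_left (hg h) _)
  have hfg : f * (1 - g) = f - f * g := by ring
  rw [hfg] at h
  simp only [expec_sub, expec_one] at h
  linarith

end Expectation

section Connectivity

variable {V E : Type} {G : PercGraph V E}

theorem le_iff_open {ω ω' : E → Bool} : ω ≤ ω' ↔ ∀ e, ω e = true → ω' e = true := by
  simp only [Pi.le_def, Bool.le_iff_imp]

theorem adj_symm {ω : E → Bool} {x y : V} (h : G.adj ω x y) : G.adj ω y x := by
  obtain ⟨e, he, h⟩ := h
  exact ⟨e, he, h.symm⟩

theorem Conn.symm {ω : E → Bool} {x y : V} (h : G.Conn ω x y) : G.Conn ω y x := by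
  induction h with
  | refl => exact .refl
  | tail _ h ih => exact Relation.ReflTransGen.head (adj_symm h) ih

theorem Conn.trans {ω : E → Bool} {x y z : V} (h : G.Conn ω x y) (h' : G.Conn ω y z) :
    G.Conn ω x z :=
  Relation.ReflTransGen.trans h h'

theorem Conn.mono {ω ω' : E → Bool} (hω : ω ≤ ω') {x y : V} (h : G.Conn ω x y) :
    G.Conn ω' x y :=
  Relation.ReflTransGen.mono (r := G.adj ω) (p := G.adj ω')
    (fun _ _ ⟨e, he, h⟩ => ⟨e, le_iff_open.1 hω e he, h⟩) _ _ h

theorem mem_cluster_singleton {ω : E → Bool} {s y : V} :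
    y ∈ G.cluster ω {s} ↔ G.Conn ω s y := by
  simp [cluster]

theorem cluster_mono {ω ω' : E → Bool} (hω : ω ≤ ω') (A : Set V) :
    G.cluster ω A ⊆ G.cluster ω' A :=
  fun _ ⟨a, ha, h⟩ => ⟨a, ha, h.mono hω⟩

theorem disconn_anti {X Y : Set V} (A : Set V) (h : X ⊆ Y) : G.disconn A Y ⊆ G.disconn A X :=
  fun _ hω a ha b hb => hω a ha b (h hb)

theorem mem_disconn_singleton_left {ω : E → Bool} {s : V} {X : Set V} :
    ω ∈ G.disconn {s} X ↔ ∀ x ∈ X, ¬ G.Conn ω s x := by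
  simp [disconn]

theorem disconn_union (A X Y : Set V) :
    G.disconn A (X ∪ Y) = G.disconn A X ∩ G.disconn A Y := by
  ext ω
  simp only [disconn, Set.mem_ofPred_eq, Set.mem_union, Set.mem_inter_iff]
  grind

theorem indicator_disconn_antitone (A X : Set V) :
    Antitone ((G.disconn A X).indicator (1 : (E → Bool) → ℝ)) := by
  classical
  intro ω ω' h
  simp only [Set.indicator_apply, Pi.one_apply]
  split_ifs with h₁ h₂
  · rfl
  · exact (h₂ fun a ha b hb hc => h₁ a ha b hb (hc.mono h)).elim
  · exact zero_le_one
  · rfl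

theorem not_conn_of_no_edge {ω : E → Bool} {s z : V} (hs : s ≠ z)
    (h : ∀ e u, ω e = true → ¬ (G.ends e = (z, u) ∨ G.ends e = (u, z))) : ¬ G.Conn ω s z := by
  intro hc
  rcases Relation.ReflTransGen.cases_tail hc with h' | ⟨b, _, e, he, hends⟩
  · exact hs h'.symm
  · exact h e b he hends.symm

theorem compl_disconn_inter_connEvent (a₁ a₂ b : V) :
    (G.disconn {a₁} {a₂})ᶜ ∩ G.connEvent a₁ b = (G.disconn {a₁} {a₂})ᶜ ∩ G.connEvent a₂ b := by
  ext ω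
  simp only [Set.mem_inter_iff, Set.mem_compl_iff, mem_disconn_singleton_left,
    Set.mem_singleton_iff, forall_eq, not_not, connEvent, Set.mem_ofPred_eq]
  exact and_congr_right fun h => ⟨h.symm.trans, h.trans⟩

theorem indicator_one_antitone {Q : Set (E → Bool)} (hQ : DecreasingEvent Q) :
    Antitone (Q.indicator (1 : (E → Bool) → ℝ)) := by
  classical
  intro ω ω' h
  simp only [Set.indicator_apply, Pi.one_apply]
  have := hQ (le_iff_open.1 h)
  split_ifs <;> simp_all

theorem clusterDetermined_indicator_one {s : V} {Q : Set (E → Bool)}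
    (hQ : G.ClusterDeterminedEvent {s} Q) :
    G.ClusterDetermined {s} (Q.indicator 1) := by
  classical
  intro ω ω' h
  simp only [Set.indicator_apply, hQ ω ω' h, Pi.one_apply]

variable [DecidableEq E]

theorem conn_update_true_iff {η : E → Bool} {e : E} {s z u : V} {X : Set V} (hz : z ∈ X)
    (he : G.ends e = (z, u) ∨ G.ends e = (u, z)) (hη : η ∈ G.disconn {s} (insert u X)) (y : V) :
    G.Conn (Function.update η e true) s y ↔ G.Conn η s y := by
  rw [mem_disconn_singleton_left] at hη
  constructor
  · intro h
    induction h with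
    | refl => exact .refl
    | @tail b c _ hbc ih =>
      obtain ⟨e', he', hends⟩ := hbc
      by_cases hee : e' = e
      · subst hee
        have hbs : b = z ∨ b = u := by
          rcases he with he | he <;> rw [he] at hends <;> simp only [Prod.mk.injEq] at hends <;>
            grind
        rcases hbs with rfl | rfl
        · exact (hη _ (Set.mem_insert_of_mem _ hz) ih).elim
        · exact (hη _ (Set.mem_insert _ _) ih).elim
      · rw [Function.update_of_ne hee] at he'
        exact Relation.ReflTransGen.tail ih ⟨e', he', hends⟩
  · refine Conn.mono (le_iff_open.2 fun i hi => ?_)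
    by_cases h : i = e
    · subst h; simp
    · rwa [Function.update_of_ne h]

theorem update_true_mem_disconn_iff {η : E → Bool} {e : E} {s z u : V} {X : Set V} (hz : z ∈ X)
    (he : G.ends e = (z, u) ∨ G.ends e = (u, z)) :
    Function.update η e true ∈ G.disconn {s} X ↔ η ∈ G.disconn {s} (insert u X) := by
  constructor
  · intro h
    rw [mem_disconn_singleton_left] at h ⊢
    have hle : η ≤ Function.update η e true := le_iff_open.2 fun i hi => by
      by_cases h : i = e
      · subst h; simp
      · rwa [Function.update_of_ne h]
    intro x hx hsx
    rcases hx with rfl | hx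
    · exact h z hz ((hsx.mono hle).trans (.single ⟨e, by simp, he.symm⟩))
    · exact h x hx (hsx.mono hle)
  · intro h
    rw [mem_disconn_singleton_left]
    intro x hx hc
    rw [conn_update_true_iff hz he h] at hc
    exact mem_disconn_singleton_left.1 h x (Set.mem_insert_of_mem _ hx) hc

theorem indicator_disconn_update_true {f : (E → Bool) → ℝ} {s : V}
    (hf : G.ClusterDetermined {s} f) {η : E → Bool} {e : E} {z u : V} {X : Set V} (hz : z ∈ X)
    (he : G.ends e = (z, u) ∨ G.ends e = (u, z)) :
    (G.disconn {s} X).indicator f (Function.update η e true)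
      = (G.disconn {s} (insert u X)).indicator f η := by
  classical
  simp only [Set.indicator_apply, update_true_mem_disconn_iff hz he]
  split_ifs with h
  · refine hf _ _ (Set.ext fun y => ?_)
    rw [mem_cluster_singleton, mem_cluster_singleton, conn_update_true_iff hz he h]
  · rfl

/-- The configuration `ω` with all edges outside `F` closed. -/
def restrict (F : Finset E) (ω : E → Bool) : E → Bool := fun e => ω e && decide (e ∈ F)

theorem restrict_mono (F : Finset E) : Monotone (restrict F) := fun ω ω' h =>
  le_iff_open.2 fun e he => by
    simp only [restrict, Bool.and_eq_true] at he ⊢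
    exact ⟨le_iff_open.1 h e he.1, he.2⟩

theorem restrict_univ [Fintype E] (ω : E → Bool) : restrict Finset.univ ω = ω := by
  ext; simp [restrict]

theorem restrict_update_false (F : Finset E) (ω : E → Bool) (e : E) :
    restrict F (Function.update ω e false) = restrict (F.erase e) ω := by
  funext i
  by_cases h : i = e <;> simp [restrict, h]

theorem restrict_update_true {F : Finset E} (ω : E → Bool) {e : E} (he : e ∈ F) :
    restrict F (Function.update ω e true)
      = Function.update (restrict (F.erase e) ω) e true := by
  funext i
  by_cases h : i = e
  · subst h; simp [restrict, he]
  · simp [restrict, h]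

end Connectivity

theorem two_point_four_functions {p a₀ a₁ b₀ b₁ c₀ c₁ d₀ d₁ : ℝ} (hp : 0 ≤ p) (hp' : p ≤ 1)
    (ha₀ : 0 ≤ a₀) (ha₁ : 0 ≤ a₁) (hb₀ : 0 ≤ b₀) (hb₁ : 0 ≤ b₁) (hc₀ : 0 ≤ c₀) (hc₁ : 0 ≤ c₁)
    (hd₀ : 0 ≤ d₀) (h₀₀ : a₀ * b₀ ≤ c₀ * d₀) (h₀₁ : a₀ * b₁ ≤ c₀ * d₁)
    (h₁₀ : a₁ * b₀ ≤ c₀ * d₁) (h₁₁ : a₁ * b₁ ≤ c₁ * d₁) :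
    ((1 - p) * a₀ + p * a₁) * ((1 - p) * b₀ + p * b₁)
      ≤ ((1 - p) * c₀ + p * c₁) * ((1 - p) * d₀ + p * d₁) := by
  have hcross : a₀ * b₁ + a₁ * b₀ ≤ c₀ * d₁ + c₁ * d₀ := by
    have hprod : (a₀ * b₁) * (a₁ * b₀) ≤ (c₀ * d₁) * (c₁ * d₀) := by
      have := mul_le_mul h₀₀ h₁₁ (mul_nonneg ha₁ hb₁) (mul_nonneg hc₀ hd₀)
      linarith
    have hx := mul_nonneg ha₀ hb₁
    have hy := mul_nonneg ha₁ hb₀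
    have hn := mul_nonneg hc₁ hd₀
    generalize a₀ * b₁ = x at *
    generalize a₁ * b₀ = y at *
    generalize c₀ * d₁ = m at *
    generalize c₁ * d₀ = n at *
    rcases (hx.trans h₀₁).eq_or_lt with hm | hm
    · linarith
    · have := mul_nonneg (sub_nonneg.2 h₀₁) (sub_nonneg.2 h₁₀)
      refine le_of_mul_le_mul_left ?_ hm
      linarith
  have hq : 0 ≤ 1 - p := sub_nonneg.2 hp'
  have e₀ := mul_le_mul_of_nonneg_left h₀₀ (mul_nonneg hq hq)
  have e₁ := mul_le_mul_of_nonneg_left hcross (mul_nonneg hq hp)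
  have e₂ := mul_le_mul_of_nonneg_left h₁₁ (mul_nonneg hp hp)
  linarith

section Correlation

variable {V E : Type} [Fintype E] [DecidableEq E] {G : PercGraph V E}

theorem expec_indicator_disconn_restrict {f : (E → Bool) → ℝ} {s : V}
    (hf : G.ClusterDetermined {s} f) {F : Finset E} {e : E} (heF : e ∈ F) {z u : V} {X : Set V}
    (hz : z ∈ X) (he : G.ends e = (z, u) ∨ G.ends e = (u, z)) :
    G.expec ((G.disconn {s} X).indicator f ∘ restrict F)
      = (1 - G.p e) * G.expec ((G.disconn {s} X).indicator f ∘ restrict (F.erase e))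
        + G.p e * G.expec ((G.disconn {s} (insert u X)).indicator f ∘ restrict (F.erase e)) := by
  rw [expec_eq_update G e]
  simp only [Function.comp_apply, restrict_update_false, restrict_update_true _ heF,
    indicator_disconn_update_true hf hz he]
  rfl

/-- A set version of the van den Berg–Häggström–Kahn inequality. -/
theorem expec_disconn_mul_le (hp : G.ProbValid) {s : V} {f g : (E → Bool) → ℝ}
    (hf₀ : 0 ≤ f) (hg₀ : 0 ≤ g) (hf : Monotone f) (hg : Monotone g)
    (hfs : G.ClusterDetermined {s} f) (hgs : G.ClusterDetermined {s} g) (F : Finset E) :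
    ∀ X Y : Set V,
      G.expec ((G.disconn {s} X).indicator f ∘ restrict F)
          * G.expec ((G.disconn {s} Y).indicator g ∘ restrict F)
        ≤ G.expec ((G.disconn {s} (X ∩ Y)).indicator (f * g) ∘ restrict F)
          * G.expec ((G.disconn {s} (X ∪ Y)).indicator 1 ∘ restrict F) := by
  have hfg₀ : 0 ≤ f * g := mul_nonneg hf₀ hg₀
  have hfgs : G.ClusterDetermined {s} (f * g) := fun ω ω' h => by
    simp only [Pi.mul_apply, hfs ω ω' h, hgs ω ω' h]
  have h1s : G.ClusterDetermined {s} 1 := fun _ _ _ => rfl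
  have hnn : ∀ {φ : (E → Bool) → ℝ} (_ : 0 ≤ φ) (X : Set V) (F : Finset E),
      0 ≤ G.expec ((G.disconn {s} X).indicator φ ∘ restrict F) := fun hφ X F =>
    expec_nonneg hp fun ω => Set.indicator_nonneg (fun _ _ => hφ _) _
  induction F using Finset.strongInduction with
  | H F ih =>
  intro X Y
  by_cases hex : ∃ e ∈ F, ∃ z ∈ X ∩ Y, ∃ u, G.ends e = (z, u) ∨ G.ends e = (u, z)
  · obtain ⟨e, heF, z, hz, u, he⟩ := hex
    have ih' := ih _ (Finset.erase_ssubset heF)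
    have hanti : ∀ {X' : Set V}, X ∩ Y ⊆ X' →
        G.expec ((G.disconn {s} X').indicator (f * g) ∘ restrict (F.erase e))
          ≤ G.expec ((G.disconn {s} (X ∩ Y)).indicator (f * g) ∘ restrict (F.erase e)) :=
      fun h => expec_mono hp fun ω =>
        Set.indicator_le_indicator_of_subset (disconn_anti _ h) hfg₀ _
    rw [expec_indicator_disconn_restrict hfs heF hz.1 he,
      expec_indicator_disconn_restrict hgs heF hz.2 he,
      expec_indicator_disconn_restrict hfgs heF hz he,
      expec_indicator_disconn_restrict h1s heF (Set.mem_union_left _ hz.1) he]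
    refine two_point_four_functions (hp e).1 (hp e).2 (hnn hf₀ _ _) (hnn hf₀ _ _) (hnn hg₀ _ _)
      (hnn hg₀ _ _) (hnn hfg₀ _ _) (hnn hfg₀ _ _) (hnn zero_le_one _ _)
      (ih' X Y) ?_ ?_ ?_
    · refine (ih' X (insert u Y)).trans ?_
      rw [Set.union_insert]
      exact mul_le_mul_of_nonneg_right
        (hanti (Set.inter_subset_inter_right _ (Set.subset_insert _ _))) (hnn zero_le_one _ _)
    · refine (ih' (insert u X) Y).trans ?_
      rw [Set.insert_union]
      exact mul_le_mul_of_nonneg_right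
        (hanti (Set.inter_subset_inter_left _ (Set.subset_insert _ _))) (hnn zero_le_one _ _)
    · refine (ih' (insert u X) (insert u Y)).trans_eq ?_
      rw [← Set.insert_inter_distrib, ← Set.insert_union_distrib]
  · by_cases hs : s ∈ X ∩ Y
    · have h0 : (G.disconn {s} X).indicator f = 0 := by
        have : G.disconn {s} X = ∅ := Set.eq_empty_of_forall_notMem fun ω hω =>
          mem_disconn_singleton_left.1 hω s hs.1 .refl
        rw [this, Set.indicator_empty]; rfl
      have h0' : G.expec ((G.disconn {s} X).indicator f ∘ restrict F) = 0 := by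
        rw [h0]; simp [expec]
      rw [h0', zero_mul]
      exact mul_nonneg (hnn hfg₀ _ _) (hnn zero_le_one _ _)
    · have hD : (G.disconn {s} (X ∩ Y)).indicator (f * g) ∘ restrict F
          = (f ∘ restrict F) * (g ∘ restrict F) := by
        funext ω
        rw [Function.comp_apply, Set.indicator_of_mem]
        · rfl
        · rw [mem_disconn_singleton_left]
          intro z hz
          refine not_conn_of_no_edge (fun h => hs (h ▸ hz)) fun e u he hends => ?_
          simp only [restrict, Bool.and_eq_true, decide_eq_true_eq] at he
          exact hex ⟨e, he.2, z, hz, u, hends⟩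
      have hsplit : ∀ (φ : (E → Bool) → ℝ) (X : Set V),
          (G.disconn {s} X).indicator φ ∘ restrict F
            = (φ ∘ restrict F) * ((G.disconn {s} X).indicator 1 ∘ restrict F) := fun φ X => by
        classical
        funext ω
        simp [Set.indicator_apply]
      have hone : (G.disconn {s} (X ∪ Y)).indicator (1 : (E → Bool) → ℝ) ∘ restrict F
          = ((G.disconn {s} X).indicator 1 ∘ restrict F)
            * ((G.disconn {s} Y).indicator 1 ∘ restrict F) := by
        rw [disconn_union, Set.inter_indicator_one]; rfl
      have hle : ∀ X : Set V,
          (G.disconn {s} X).indicator (1 : (E → Bool) → ℝ) ∘ restrict F ≤ 1 := fun X ω =>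
        Set.indicator_le_self' (fun _ _ => zero_le_one) _
      have hant : ∀ X : Set V,
          Antitone ((G.disconn {s} X).indicator (1 : (E → Bool) → ℝ) ∘ restrict F) := fun X =>
        (indicator_disconn_antitone _ _).comp_monotone (restrict_mono F)
      have hf' : Monotone (f ∘ restrict F) := hf.comp (restrict_mono F)
      have hg' : Monotone (g ∘ restrict F) := hg.comp (restrict_mono F)
      have hf₀' : 0 ≤ f ∘ restrict F := fun ω => hf₀ (restrict F ω)
      have hg₀' : 0 ≤ g ∘ restrict F := fun ω => hg₀ (restrict F ω)
      rw [hD, hsplit f, hsplit g, hone]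
      calc _ ≤ (G.expec (f ∘ restrict F)
                * G.expec ((G.disconn {s} X).indicator 1 ∘ restrict F))
              * (G.expec (g ∘ restrict F)
                * G.expec ((G.disconn {s} Y).indicator 1 ∘ restrict F)) := by
            refine mul_le_mul (harris_monotone_antitone hp hf₀' (hle X) hf' (hant X))
              (harris_monotone_antitone hp hg₀' (hle Y) hg' (hant Y)) ?_
              (mul_nonneg (expec_nonneg hp hf₀') (hnn zero_le_one _ _))
            rw [← hsplit]
            exact hnn hg₀ _ _
        _ = (G.expec (f ∘ restrict F) * G.expec (g ∘ restrict F))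
              * (G.expec ((G.disconn {s} X).indicator 1 ∘ restrict F)
                * G.expec ((G.disconn {s} Y).indicator 1 ∘ restrict F)) := by ring
        _ ≤ _ := mul_le_mul (harris hp hf₀' hg₀' hf' hg')
            (harris_antitone hp (hle X) (hle Y) (hant X) (hant Y))
            (mul_nonneg (hnn zero_le_one _ _) (hnn zero_le_one _ _))
            (expec_nonneg hp (mul_nonneg hf₀' hg₀'))

/-- Conditionally on `s ↮ X`, increasing functions of the cluster of `s` are positively
correlated. -/
theorem expec_disconn_mul_le_of_monotone (hp : G.ProbValid) {s : V} {f g : (E → Bool) → ℝ}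
    (hf₀ : 0 ≤ f) (hg₀ : 0 ≤ g) (hf : Monotone f) (hg : Monotone g)
    (hfs : G.ClusterDetermined {s} f) (hgs : G.ClusterDetermined {s} g) (X : Set V) :
    G.expec ((G.disconn {s} X).indicator f) * G.expec ((G.disconn {s} X).indicator g)
      ≤ G.expec ((G.disconn {s} X).indicator (f * g)) * G.prob (G.disconn {s} X) := by
  have h := expec_disconn_mul_le hp hf₀ hg₀ hf hg hfs hgs Finset.univ X X
  have hr : restrict (Finset.univ : Finset E) = id := funext restrict_univ
  rwa [Set.inter_self, Set.union_self, hr, Function.comp_id, Function.comp_id, Function.comp_id,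
    Function.comp_id, ← prob_eq_expec] at h

/-- Conditionally on `s ↮ X`, decreasing functions of the cluster of `s` are positively
correlated. -/
theorem expec_disconn_mul_le_of_antitone (hp : G.ProbValid) {s : V} {f g : (E → Bool) → ℝ}
    (hf₁ : f ≤ 1) (hg₁ : g ≤ 1) (hf : Antitone f) (hg : Antitone g)
    (hfs : G.ClusterDetermined {s} f) (hgs : G.ClusterDetermined {s} g) (X : Set V) :
    G.expec ((G.disconn {s} X).indicator f) * G.expec ((G.disconn {s} X).indicator g)
      ≤ G.expec ((G.disconn {s} X).indicator (f * g)) * G.prob (G.disconn {s} X) := by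
  have h := expec_disconn_mul_le_of_monotone hp (f := 1 - f) (g := 1 - g) (s := s)
    (sub_nonneg.2 hf₁) (sub_nonneg.2 hg₁)
    (fun _ _ h => sub_le_sub_left (hf h) _) (fun _ _ h => sub_le_sub_left (hg h) _)
    (fun _ _ h => congrArg (1 - ·) (hfs _ _ h)) (fun _ _ h => congrArg (1 - ·) (hgs _ _ h)) X
  have hfg : (1 - f) * (1 - g) = 1 - f - (g - f * g) := by ring
  rw [hfg] at h
  simp only [Set.indicator_sub', expec_sub, ← prob_eq_expec] at h
  linarith

/-- Conditionally on `s ↮ X`, an increasing and a decreasing function of the cluster of `s` are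
negatively correlated. -/
theorem le_expec_disconn_mul (hp : G.ProbValid) {s : V} {f g : (E → Bool) → ℝ}
    (hf₀ : 0 ≤ f) (hg₁ : g ≤ 1) (hf : Monotone f) (hg : Antitone g)
    (hfs : G.ClusterDetermined {s} f) (hgs : G.ClusterDetermined {s} g) (X : Set V) :
    G.expec ((G.disconn {s} X).indicator (f * g)) * G.prob (G.disconn {s} X)
      ≤ G.expec ((G.disconn {s} X).indicator f) * G.expec ((G.disconn {s} X).indicator g) := by
  have h := expec_disconn_mul_le_of_monotone hp (g := 1 - g) (s := s) hf₀
    (sub_nonneg.2 hg₁) hf (fun _ _ h => sub_le_sub_left (hg h) _)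
    hfs (fun _ _ h => congrArg (1 - ·) (hgs _ _ h)) X
  have hfg : f * (1 - g) = f - f * g := by ring
  rw [hfg] at h
  simp only [Set.indicator_sub', expec_sub, ← prob_eq_expec] at h
  linarith

end Correlation

section Resampling

variable {V E : Type} {G : PercGraph V E}

/-- The edge `e` has an endpoint in `C`. -/
def touches (G : PercGraph V E) (C : Set V) (e : E) : Prop :=
  (G.ends e).1 ∈ C ∨ (G.ends e).2 ∈ C

open Classical in
/-- The configuration equal to `ω` on the edges touching `C` and to `ω'` elsewhere. -/
noncomputable def splice (G : PercGraph V E) (C : Set V) (ω ω' : E → Bool) : E → Bool :=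
  fun e => if G.touches C e then ω e else ω' e

theorem splice_splice (C : Set V) (ω₁ ω₂ ω₃ ω₄ : E → Bool) :
    G.splice C (G.splice C ω₁ ω₂) (G.splice C ω₃ ω₄) = G.splice C ω₁ ω₄ := by
  funext e
  by_cases h : G.touches C e <;> simp [splice, h]

theorem splice_self (C : Set V) (ω : E → Bool) : G.splice C ω ω = ω := by
  funext e
  simp [splice]

theorem adj_congr_of_touches {C : Set V} {ω ω' : E → Bool}
    (h : ∀ e, G.touches C e → ω e = ω' e) {x y : V} (hx : x ∈ C) :
    G.adj ω x y ↔ G.adj ω' x y := by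
  refine exists_congr fun e => and_congr_left fun hends => ?_
  rw [h e (hends.imp (fun h => by rwa [h]) (fun h => by rwa [h]))]

theorem cluster_eq_of_eq_on_touches {s : V} {ω ω' : E → Bool}
    (h : ∀ e, G.touches (G.cluster ω {s}) e → ω e = ω' e) :
    G.cluster ω' {s} = G.cluster ω {s} := by
  ext y
  rw [mem_cluster_singleton, mem_cluster_singleton]
  constructor <;> intro hy
  · induction hy with
    | refl => exact .refl
    | tail _ hbc ih =>
      exact ih.tail ((adj_congr_of_touches h (mem_cluster_singleton.2 ih)).2 hbc)
  · induction hy with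
    | refl => exact .refl
    | tail hsb hbc ih =>
      exact ih.tail ((adj_congr_of_touches h (mem_cluster_singleton.2 hsb)).1 hbc)

theorem cluster_splice (s : V) (ω ω' : E → Bool) :
    G.cluster (G.splice (G.cluster ω {s}) ω ω') {s} = G.cluster ω {s} :=
  cluster_eq_of_eq_on_touches fun e he => by simp [splice, he]

/-- Off the cluster of `s`, only edges not touching that cluster matter. -/
theorem conn_splice_false_iff {s a b : V} {ω : E → Bool} (ha : a ∉ G.cluster ω {s}) :
    G.Conn (G.splice (G.cluster ω {s}) (fun _ => false) ω) a b ↔ G.Conn ω a b := by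
  constructor
  · refine Conn.mono (le_iff_open.2 fun e he => ?_)
    by_cases h : G.touches (G.cluster ω {s}) e <;> simp_all [splice]
  · intro h
    have hnot : ∀ y, G.Conn ω a y → y ∉ G.cluster ω {s} := fun y hy hys =>
      ha (mem_cluster_singleton.2 ((mem_cluster_singleton.1 hys).trans hy.symm))
    induction h with
    | refl => exact .refl
    | @tail y z hay hyz ih =>
      refine ih.tail ?_
      have hy := hnot y hay
      have hz := hnot z (Relation.ReflTransGen.tail hay hyz)
      obtain ⟨e, he, hends⟩ := hyz
      refine ⟨e, ?_, hends⟩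
      have : ¬ G.touches (G.cluster ω {s}) e := by
        rcases hends with h | h <;> simp [touches, h, hy, hz]
      simp [splice, this, he]

variable [Fintype E]

theorem weight_splice_mul_weight_splice (C : Set V) (ω ω' : E → Bool) :
    G.weight (G.splice C ω ω') * G.weight (G.splice C ω' ω) = G.weight ω * G.weight ω' := by
  unfold weight
  rw [← Finset.prod_mul_distrib, ← Finset.prod_mul_distrib]
  refine Finset.prod_congr rfl fun e _ => ?_
  by_cases h : G.touches C e <;> simp [splice, h, mul_comm]

variable [DecidableEq E]

/-- Resampling the edges which do not touch the cluster of `s` preserves the measure. -/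
theorem expec_eq_expec_expec_splice (G : PercGraph V E) (s : V) (φ : (E → Bool) → ℝ) :
    G.expec φ = G.expec fun ω => G.expec fun ω' => φ (G.splice (G.cluster ω {s}) ω ω') := by
  let T : (E → Bool) × (E → Bool) → (E → Bool) × (E → Bool) := fun x =>
    (G.splice (G.cluster x.1 {s}) x.1 x.2, G.splice (G.cluster x.1 {s}) x.2 x.1)
  have hT : Function.Involutive T := fun x => by
    simp only [T, cluster_splice, splice_splice, splice_self]
  calc G.expec φ = ∑ x : (E → Bool) × (E → Bool), φ x.1 * (G.weight x.1 * G.weight x.2) := by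
        rw [Fintype.sum_prod_type]
        simp only [← Finset.mul_sum, sum_weight, mul_one, expec]
    _ = ∑ x : (E → Bool) × (E → Bool), φ (T x).1 * (G.weight x.1 * G.weight x.2) := by
        symm
        refine Fintype.sum_bijective T hT.bijective _ _ fun x => ?_
        rw [← weight_splice_mul_weight_splice (G.cluster x.1 {s}) x.1 x.2]
    _ = _ := by
        rw [Fintype.sum_prod_type]
        simp only [expec, Finset.sum_mul]
        refine Finset.sum_congr rfl fun ω _ => Finset.sum_congr rfl fun ω' _ => ?_
        simp only [T]
        ring

/-- The probability that `a` and `b` are connected by open edges not touching `C`. -/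
noncomputable def probConnOff (G : PercGraph V E) (a b : V) (C : Set V) : ℝ :=
  G.prob {ω | G.Conn (G.splice C (fun _ => false) ω) a b}

theorem probConnOff_le_one (hp : G.ProbValid) (a b : V) (C : Set V) :
    G.probConnOff a b C ≤ 1 := by
  rw [← G.expec_one, probConnOff, prob_eq_expec]
  exact expec_mono hp fun ω => Set.indicator_le_self' (fun _ _ => zero_le_one) _

theorem probConnOff_antitone (hp : G.ProbValid) (a b : V) : Antitone (G.probConnOff a b) := by
  intro C C' h
  rw [probConnOff, probConnOff, prob_eq_expec, prob_eq_expec]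
  refine expec_mono hp fun ω => Set.indicator_le_indicator_of_subset (fun ω' hω' => ?_)
    (fun _ => zero_le_one) _
  refine Conn.mono (le_iff_open.2 fun e he => ?_) hω'
  have : G.touches C e → G.touches C' e := Or.imp (fun h' => h h') (fun h' => h h')
  by_cases h₁ : G.touches C e <;> by_cases h₂ : G.touches C' e <;> simp_all [splice]

/-- Given the cluster of `s`, not containing `a`, the conditional probability of `a ↔ b` is
`probConnOff a b` of that cluster. -/
theorem expec_indicator_disconn_connEvent {g : (E → Bool) → ℝ} {s : V}
    (hgs : G.ClusterDetermined {s} g) (a b : V) :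
    G.expec ((G.disconn {s} {a}).indicator ((G.connEvent a b).indicator 1 * g))
      = G.expec ((G.disconn {s} {a}).indicator
          ((fun ω => G.probConnOff a b (G.cluster ω {s})) * g)) := by
  classical
  have hD : ∀ ω, ω ∈ G.disconn {s} {a} ↔ a ∉ G.cluster ω {s} := fun ω => by
    simp [mem_disconn_singleton_left, mem_cluster_singleton]
  rw [expec_eq_expec_expec_splice G s]
  refine congrArg G.expec (funext fun ω => ?_)
  simp only [Set.indicator_apply (G.disconn {s} {a}), hD, cluster_splice]
  split_ifs with h
  · simp [expec]
  · simp only [Pi.mul_apply, probConnOff, prob_eq_expec, expec, Finset.sum_mul]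
    refine Finset.sum_congr rfl fun ω' _ => ?_
    rw [hgs _ ω (cluster_splice s ω ω')]
    have hc : G.splice (G.cluster ω {s}) ω ω' ∈ G.connEvent a b ↔
        ω' ∈ {ω' | G.Conn (G.splice (G.cluster ω {s}) (fun _ => false) ω') a b} := by
      have h' : a ∉ G.cluster (G.splice (G.cluster ω {s}) ω ω') {s} := by rwa [cluster_splice]
      have := conn_splice_false_iff (b := b) h'
      rw [cluster_splice] at this
      rw [connEvent, Set.mem_ofPred_eq, ← this, Set.mem_ofPred_eq]
      have he : G.splice (G.cluster ω {s}) (fun _ => false) (G.splice (G.cluster ω {s}) ω ω')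
          = G.splice (G.cluster ω {s}) (fun _ => false) ω' := by
        funext e
        by_cases h : G.touches (G.cluster ω {s}) e <;> simp [splice, h]
      rw [he]
    simp only [Set.indicator_apply, hc, Pi.one_apply]
    ring

end Resampling

section Comparison

variable {V E : Type} [Fintype E] [DecidableEq E] {G : PercGraph V E}

theorem prob_nonneg (hp : G.ProbValid) (S : Set (E → Bool)) : 0 ≤ G.prob S :=
  Finset.sum_nonneg fun _ _ => Set.indicator_nonneg (fun _ _ => weight_nonneg hp _) _

theorem prob_mono (hp : G.ProbValid) {S T : Set (E → Bool)} (h : S ⊆ T) : G.prob S ≤ G.prob T :=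
  Finset.sum_le_sum fun _ _ =>
    Set.indicator_le_indicator_of_subset h (fun _ => weight_nonneg hp _) _

theorem prob_inter_add_prob_inter_compl (G : PercGraph V E) (S T : Set (E → Bool)) :
    G.prob (T ∩ S) + G.prob (Tᶜ ∩ S) = G.prob S := by
  classical
  simp only [prob, ← Finset.sum_add_distrib]
  refine Finset.sum_congr rfl fun ω _ => ?_
  by_cases h : ω ∈ T <;> simp [Set.indicator_apply, h]

theorem prob_inter_eq_expec_indicator (G : PercGraph V E) (D S : Set (E → Bool)) :
    G.prob (D ∩ S) = G.expec (D.indicator (S.indicator 1)) := by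
  rw [prob_eq_expec, Set.indicator_indicator]

theorem prob_connEvent_inter_sub (G : PercGraph V E) (a₁ a₂ b : V) (S : Set (E → Bool)) :
    G.prob (G.connEvent a₁ b ∩ S) - G.prob (G.connEvent a₂ b ∩ S)
      = G.prob (G.disconn {a₁} {a₂} ∩ (G.connEvent a₁ b ∩ S))
        - G.prob (G.disconn {a₁} {a₂} ∩ (G.connEvent a₂ b ∩ S)) := by
  rw [← prob_inter_add_prob_inter_compl G (G.connEvent a₁ b ∩ S) (G.disconn {a₁} {a₂}),
    ← prob_inter_add_prob_inter_compl G (G.connEvent a₂ b ∩ S) (G.disconn {a₁} {a₂}),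
    ← Set.inter_assoc (_)ᶜ, ← Set.inter_assoc (_)ᶜ, compl_disconn_inter_connEvent]
  ring

variable {s : V} {Q : Set (E → Bool)}

/-- Conditionally on `s ↮ X`, the event `s ↔ b` is negatively correlated with decreasing events
determined by the cluster of `s`. -/
theorem prob_disconn_connEvent_inter_le (hp : G.ProbValid) (hQdec : DecreasingEvent Q)
    (hQdet : G.ClusterDeterminedEvent {s} Q) (b : V) (X : Set V) :
    G.prob (G.disconn {s} X ∩ (G.connEvent s b ∩ Q)) * G.prob (G.disconn {s} X)
      ≤ G.prob (G.disconn {s} X ∩ G.connEvent s b) * G.prob (G.disconn {s} X ∩ Q) := by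
  classical
  have hmono : Monotone ((G.connEvent s b).indicator (1 : (E → Bool) → ℝ)) := by
    intro ω ω' h
    have : ω ∈ G.connEvent s b → ω' ∈ G.connEvent s b := Conn.mono h
    simp only [Set.indicator_apply, Pi.one_apply]
    split_ifs <;> simp_all
  have hdet : G.ClusterDeterminedEvent {s} (G.connEvent s b) := fun ω ω' h => by
    rw [connEvent, Set.mem_ofPred_eq, Set.mem_ofPred_eq, ← mem_cluster_singleton, h,
      mem_cluster_singleton]
  have h := le_expec_disconn_mul hp (s := s) (f := (G.connEvent s b).indicator 1)
    (g := Q.indicator 1)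
    (Set.indicator_nonneg fun _ _ => zero_le_one)
    (Set.indicator_le_self' fun _ _ => zero_le_one) hmono (indicator_one_antitone hQdec)
    (clusterDetermined_indicator_one hdet) (clusterDetermined_indicator_one hQdet) X
  rwa [← Set.inter_indicator_one, ← prob_inter_eq_expec_indicator,
    ← prob_inter_eq_expec_indicator, ← prob_inter_eq_expec_indicator] at h

/-- Conditionally on `s ↮ a`, the event `a ↔ b` is positively correlated with decreasing events
determined by the cluster of `s`. -/
theorem le_prob_disconn_connEvent_inter (hp : G.ProbValid) (hQdec : DecreasingEvent Q)
    (hQdet : G.ClusterDeterminedEvent {s} Q) (a b : V) :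
    G.prob (G.disconn {s} {a} ∩ G.connEvent a b) * G.prob (G.disconn {s} {a} ∩ Q)
      ≤ G.prob (G.disconn {s} {a} ∩ (G.connEvent a b ∩ Q)) * G.prob (G.disconn {s} {a}) := by
  have hQs := clusterDetermined_indicator_one hQdet
  have h := expec_disconn_mul_le_of_antitone hp (s := s)
    (f := fun ω => G.probConnOff a b (G.cluster ω {s})) (g := Q.indicator 1)
    (fun ω => probConnOff_le_one hp _ _ _) (Set.indicator_le_self' fun _ _ => zero_le_one)
    (fun _ _ h => probConnOff_antitone hp a b (cluster_mono h _)) (indicator_one_antitone hQdec)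
    (fun _ _ h => congrArg (G.probConnOff a b) h) hQs {a}
  have h1 := expec_indicator_disconn_connEvent (g := 1) (s := s) (G := G) (fun _ _ _ => rfl) a b
  rw [mul_one, mul_one] at h1
  rwa [← h1, ← expec_indicator_disconn_connEvent hQs, ← Set.inter_indicator_one,
    ← prob_inter_eq_expec_indicator, ← prob_inter_eq_expec_indicator,
    ← prob_inter_eq_expec_indicator] at h

end Comparison

end PercGraph

/-- comparison lemma, joint version for a decreasing event determined
by the cluster of `a₁`. -/
theorem compare_joint_decreasing
    {V E : Type} [DecidableEq V] [Fintype E] [DecidableEq E]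
    (G : PercGraph V E) (hp : G.ProbValid) (a₁ a₂ b : V) (δ : ℝ) (hδ : 0 < δ)
    (h : G.prob (G.connEvent a₁ b) < G.prob (G.connEvent a₂ b) + δ)
    (Q : Set (E → Bool)) (hQdec : PercGraph.DecreasingEvent Q)
    (hQdet : G.ClusterDeterminedEvent {a₁} Q) :
    G.prob (G.connEvent a₁ b ∩ Q) < G.prob (G.connEvent a₂ b ∩ Q) + δ := by
  have h₀ := G.prob_connEvent_inter_sub a₁ a₂ b Set.univ
  simp only [Set.inter_univ] at h₀
  have h₁ := G.prob_connEvent_inter_sub a₁ a₂ b Q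
  have h₂ := PercGraph.prob_disconn_connEvent_inter_le hp hQdec hQdet b {a₂}
  have h₃ := PercGraph.le_prob_disconn_connEvent_inter hp hQdec hQdet a₂ b
  have hle := PercGraph.prob_mono hp
    (Set.inter_subset_left : G.disconn {a₁} {a₂} ∩ Q ⊆ G.disconn {a₁} {a₂})
  have hx := PercGraph.prob_mono hp (Set.inter_subset_left :
    G.disconn {a₁} {a₂} ∩ (G.connEvent a₁ b ∩ Q) ⊆ G.disconn {a₁} {a₂})
  have hy := PercGraph.prob_nonneg hp (G.disconn {a₁} {a₂} ∩ (G.connEvent a₂ b ∩ Q))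
  have hq := PercGraph.prob_nonneg hp (G.disconn {a₁} {a₂} ∩ Q)
  generalize G.prob (G.disconn {a₁} {a₂} ∩ (G.connEvent a₁ b ∩ Q)) = x at *
  generalize G.prob (G.disconn {a₁} {a₂} ∩ (G.connEvent a₂ b ∩ Q)) = y at *
  generalize G.prob (G.disconn {a₁} {a₂} ∩ G.connEvent a₁ b) = u at *
  generalize G.prob (G.disconn {a₁} {a₂} ∩ G.connEvent a₂ b) = v at *
  generalize G.prob (G.disconn {a₁} {a₂} ∩ Q) = q at *
  generalize G.prob (G.disconn {a₁} {a₂}) = d at *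
  suffices x - y < δ by linarith
  rcases (hq.trans hle).eq_or_lt with hd | hd
  · linarith
  · have huv : u - v < δ := by linarith
    refine lt_of_mul_lt_mul_right (a := d) ?_ hd.le
    rcases hq.eq_or_lt with hq | hq
    · subst hq
      linarith [mul_pos hδ hd]
    · linarith [mul_lt_mul_of_pos_right huv hq, mul_le_mul_of_nonneg_left hle hδ.le]
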